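/- Let X = (x₁,…,xₙ) be a vector configuration spanning ℝ^d, d ≥ 2, such that every (d−2)-dimensional linear subspace of ℝ^d spanned by a subset of {x₁,…,xₙ} is contained in exactly 2 or 3 (d−1)-dimensional linear subspaces spanned by subsets of {x₁,…,xₙ}. Let L ⊆ ℤⁿ be the lattice generated by the cocircuits of X, let π : ℝⁿ → span_ℝ(L) be the orthogonal projection with respect to the standard inner product, and set yᵢ = π(eᵢ). Then X and Y = (y₁,…,yₙ) are projectively equivalent: there exist a linear map A : ℝⁿ → ℝ^d and nonzero reals λ₁,…,λₙ with xᵢ = λᵢ A(yᵢ) for all i. -/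

import Mathlib

/-- The support of an integer vector: the set of its nonzero coordinates. -/
def supp {n : ℕ} (v : Fin n → ℤ) : Set (Fin n) := {i | v i ≠ 0}

/-- `v` is an elementary vector of the lattice `L ⊆ ℤⁿ`: it is a nonzero lattice
vector with entries in `{-1,0,+1}` whose support is minimal among supports of
nonzero lattice vectors. -/
def IsElementary {n : ℕ} (L : AddSubgroup (Fin n → ℤ)) (v : Fin n → ℤ) : Prop :=
  v ∈ L ∧ v ≠ 0 ∧ (∀ i, v i = -1 ∨ v i = 0 ∨ v i = 1) ∧
    ∀ u ∈ L, u ≠ 0 → ¬ (supp u ⊂ supp v)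

/-- A lattice `L ⊆ ℤⁿ` is zonotopal if every nonzero lattice vector's support
contains the support of some elementary vector. -/
def IsZonotopal {n : ℕ} (L : AddSubgroup (Fin n → ℤ)) : Prop :=
  ∀ v ∈ L, v ≠ 0 → ∃ u, IsElementary L u ∧ supp u ⊆ supp v

/-- The weighted inner product on `ℝⁿ` with weights `lam`. -/
def wip {n : ℕ} (lam : Fin n → ℝ) (x y : Fin n → ℝ) : ℝ := ∑ i, lam i * x i * y i

/-- Coordinatewise cast of an integer vector to a real vector. -/
def icast {n : ℕ} (v : Fin n → ℤ) : Fin n → ℝ := fun i => (v i : ℝ)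

/-- The real span `F` of a lattice `L ⊆ ℤⁿ`. -/
def latticeSpan {n : ℕ} (L : AddSubgroup (Fin n → ℤ)) : Submodule ℝ (Fin n → ℝ) :=
  Submodule.span ℝ (icast '' (L : Set (Fin n → ℤ)))

/-- The Dirichlet-Voronoi polytope of a lattice `L ⊆ ℤⁿ` with respect to the
weighted inner product with weights `lam`. -/
def DV {n : ℕ} (L : AddSubgroup (Fin n → ℤ)) (lam : Fin n → ℝ) : Set (Fin n → ℝ) :=
  {x | x ∈ latticeSpan L ∧
    ∀ v ∈ L, wip lam x (icast v) ≤ wip lam (icast v) (icast v) / 2}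

/-- `v` is a strict Voronoi vector of `L` with respect to the weighted inner
product with weights `lam`: `±v` are the unique shortest vectors of `v + 2L`. -/
def IsStrictVoronoi {n : ℕ} (L : AddSubgroup (Fin n → ℤ)) (lam : Fin n → ℝ)
    (v : Fin n → ℤ) : Prop :=
  v ∈ L ∧ v ≠ 0 ∧ ∀ w ∈ L, v + 2 • w ≠ v → v + 2 • w ≠ -v →
    wip lam (icast v) (icast v) <
      wip lam (icast (v + 2 • w)) (icast (v + 2 • w))

/-- Two integer vectors are conformal if their entries never have opposite signs. -/
def IsConformal {n : ℕ} (v w : Fin n → ℤ) : Prop := ∀ i, 0 ≤ v i * w i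

/-- The sign of a real number, as an integer in `{-1,0,+1}`. -/
noncomputable def sgnR (t : ℝ) : ℤ := if 0 < t then 1 else if t < 0 then -1 else 0

/-- A covector of the vector configuration `X`: the sign vector of the values of a
linear functional on the configuration. -/
def IsCovector {n d : ℕ} (X : Fin n → Fin d → ℝ) (s : Fin n → ℤ) : Prop :=
  ∃ f : (Fin d → ℝ) →ₗ[ℝ] ℝ, ∀ i, s i = sgnR (f (X i))

/-- A cocircuit of the vector configuration `X`: a nonzero covector of minimal support. -/
def IsCocircuit {n d : ℕ} (X : Fin n → Fin d → ℝ) (s : Fin n → ℤ) : Prop :=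
  IsCovector X s ∧ s ≠ 0 ∧ ∀ t, IsCovector X t → t ≠ 0 → ¬ (supp t ⊂ supp s)

/-- The lattice in `ℤⁿ` generated by the cocircuits of `X`. -/
def cocircuitLattice {n d : ℕ} (X : Fin n → Fin d → ℝ) : AddSubgroup (Fin n → ℤ) :=
  AddSubgroup.closure {s | IsCocircuit X s}

/-- A linear subspace of `ℝ^d` spanned by a subset of the configuration `X`. -/
def SpannedSubspace {n d : ℕ} (X : Fin n → Fin d → ℝ)
    (W : Submodule ℝ (Fin d → ℝ)) : Prop :=
  ∃ S : Set (Fin n), W = Submodule.span ℝ (X '' S)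

/-- McMullen's condition (II): every `(d-2)`-dimensional subspace spanned by vectors
of `X` is contained in exactly `2` or `3` hyperplanes spanned by vectors of `X`. -/
def ConditionII {n d : ℕ} (X : Fin n → Fin d → ℝ) : Prop :=
  ∀ W : Submodule ℝ (Fin d → ℝ), SpannedSubspace X W → Module.finrank ℝ W = d - 2 →
    {H : Submodule ℝ (Fin d → ℝ) |
        SpannedSubspace X H ∧ Module.finrank ℝ H = d - 1 ∧ W ≤ H}.ncard = 2 ∨
    {H : Submodule ℝ (Fin d → ℝ) |
        SpannedSubspace X H ∧ Module.finrank ℝ H = d - 1 ∧ W ≤ H}.ncard = 3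

/-- The zonotope generated by the vector configuration `X`, i.e. the Minkowski sum
of the segments `conv{xᵢ, -xᵢ}`. -/
def zonotope {n d : ℕ} (X : Fin n → Fin d → ℝ) : Set (Fin d → ℝ) :=
  {z | ∃ c : Fin n → ℝ, (∀ i, |c i| ≤ 1) ∧ z = ∑ i, c i • X i}

/-- `P` tiles `ℝ^d` face-to-face by translations: some family of translates of `P`
covers `ℝ^d`, and any two distinct translates intersect in a common (possibly empty)
exposed face. -/
def TilesFaceToFace {d : ℕ} (P : Set (Fin d → ℝ)) : Prop :=
  ∃ T : Set (Fin d → ℝ),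
    (∀ x, ∃ t ∈ T, x ∈ (t + ·) '' P) ∧
    ∀ s ∈ T, ∀ t ∈ T, s ≠ t →
      IsExposed ℝ ((s + ·) '' P) (((s + ·) '' P) ∩ ((t + ·) '' P)) ∧
      IsExposed ℝ ((t + ·) '' P) (((s + ·) '' P) ∩ ((t + ·) '' P))

section Helpers

variable {n d : ℕ}

/-- `f` is a system of functionals dual to a basis `X ∘ b` picked from `X`. -/
def GoodSys (X : Fin n → Fin d → ℝ) (f : Fin d → ((Fin d → ℝ) →ₗ[ℝ] ℝ)) (b : Fin d → Fin n) : Prop :=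
  ∀ k l, f k (X (b l)) = if k = l then 1 else 0

theorem GoodSys.pivot {X : Fin n → Fin d → ℝ} {f : Fin d → ((Fin d → ℝ) →ₗ[ℝ] ℝ)}
    {b : Fin d → Fin n} (h : GoodSys X f b) (k₀ : Fin d) (j : Fin n) (hj : f k₀ (X j) ≠ 0) :
    GoodSys X (fun k => if k = k₀ then (f k₀ (X j))⁻¹ • f k₀
      else f k - (f k (X j) * (f k₀ (X j))⁻¹) • f k₀) (Function.update b k₀ j) := by
  intro k l
  by_cases hk : k = k₀ <;> by_cases hl : l = k₀
  · subst hk; subst hl; simp [hj]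
  · subst hk
    simp [Function.update_of_ne hl, h k l, Ne.symm hl]
  · subst hl
    simp [hk, hj]
  · simp [hk, Function.update_of_ne hl, h k l, h k₀ l, Ne.symm hl]

theorem GoodSys.linearIndependent {X : Fin n → Fin d → ℝ} {f : Fin d → ((Fin d → ℝ) →ₗ[ℝ] ℝ)}
    {b : Fin d → Fin n} (h : GoodSys X f b) : LinearIndependent ℝ (fun k => X (b k)) := by
  rw [Fintype.linearIndependent_iff]
  intro g hg k
  have := congrArg (f k) hg
  simpa [map_sum, h k] using this

theorem GoodSys.finrank_compl {X : Fin n → Fin d → ℝ} {f : Fin d → ((Fin d → ℝ) →ₗ[ℝ] ℝ)}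
    {b : Fin d → Fin n} (h : GoodSys X f b) (S : Finset (Fin d)) :
    Module.finrank ℝ (Submodule.span ℝ (X '' (b '' (S : Set (Fin d))))) = S.card := by
  have h1 : LinearIndependent ℝ (fun k : S => X (b k)) :=
    h.linearIndependent.comp (fun k : S => (k : Fin d)) Subtype.val_injective
  have h2 := finrank_span_eq_card h1
  rw [Fintype.card_coe] at h2
  have h3 : X '' (b '' (S : Set (Fin d))) = Set.range (fun k : S => X (b k)) := by
    ext x; simp
  rw [h3, h2]

theorem GoodSys.minor {X : Fin n → Fin d → ℝ} (hd : 2 ≤ d) (hII : ConditionII X)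
    {f : Fin d → ((Fin d → ℝ) →ₗ[ℝ] ℝ)}
    {b : Fin d → Fin n} (h : GoodSys X f b) {k k' : Fin d} (hk : k ≠ k') {i j : Fin n}
    (h1 : f k (X i) ≠ 0) (h2 : f k (X j) ≠ 0) (h3 : f k' (X i) ≠ 0) (h4 : f k' (X j) ≠ 0) :
    f k (X i) * f k' (X j) = f k (X j) * f k' (X i) := by
  classical
  by_contra hne
  set S : Finset (Fin d) := {k, k'}ᶜ with hS
  set W : Submodule ℝ (Fin d → ℝ) := Submodule.span ℝ (X '' (b '' (S : Set (Fin d)))) with hW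
  have hScard : S.card = d - 2 := by
    rw [hS, Finset.card_compl, Finset.card_pair hk, Fintype.card_fin]
  have hWr : Module.finrank ℝ W = d - 2 := by rw [hW, h.finrank_compl, hScard]
  set H : Fin n → Submodule ℝ (Fin d → ℝ) := fun i =>
    Submodule.span ℝ (X '' (b '' (S : Set (Fin d)) ∪ {i})) with hH
  have hfW : ∀ m ∈ W, f k m = 0 ∧ f k' m = 0 := by
    intro m hm
    have hle : W ≤ LinearMap.ker (f k) ⊓ LinearMap.ker (f k') := by
      rw [hW, Submodule.span_le]
      rintro _ ⟨_, ⟨l, hl, rfl⟩, rfl⟩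
      have hl' : l ≠ k ∧ l ≠ k' := by simpa [hS, and_comm] using hl
      simp [h k l, h k' l, hl'.1.symm, hl'.2.symm]
    simpa using hle hm
  have hHsup : ∀ i, H i = W ⊔ Submodule.span ℝ {X i} := by
    intro i; simp only [hH, hW, Set.image_union, Set.image_singleton, Submodule.span_union]
  have hWH : ∀ i, W ≤ H i := fun i => by rw [hHsup]; exact le_sup_left
  have hHr : ∀ i, (f k (X i) ≠ 0 ∨ f k' (X i) ≠ 0) → Module.finrank ℝ (H i) = d - 1 := by
    intro i hi
    have hnot : X i ∉ W := fun hm => by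
      rcases hi with hi | hi
      · exact hi (hfW _ hm).1
      · exact hi (hfW _ hm).2
    have hx0 : X i ≠ 0 := fun h0 => hnot (h0 ▸ W.zero_mem)
    have hinf : W ⊓ Submodule.span ℝ {X i} = ⊥ := by
      rw [← disjoint_iff, Submodule.disjoint_span_singleton' hx0]
      exact hnot
    have := Submodule.finrank_sup_add_finrank_inf_eq W (Submodule.span ℝ {X i})
    rw [hinf, finrank_bot, finrank_span_singleton hx0, hWr, ← hHsup] at this
    omega
  have hHne : ∀ i j, f k (X i) * f k' (X j) ≠ f k (X j) * f k' (X i) → H i ≠ H j := by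
    intro i j hij heq
    have hXj : X j ∈ H i := by
      rw [heq]; exact Submodule.subset_span ⟨j, by simp, rfl⟩
    have hle : H i ≤ LinearMap.ker (f k (X i) • f k' - f k' (X i) • f k) := by
      rw [hHsup, sup_le_iff]
      constructor
      · intro m hm
        simp [(hfW m hm).1, (hfW m hm).2]
      · rw [Submodule.span_singleton_le_iff_mem]
        simp [mul_comm]
    have := hle hXj
    simp only [LinearMap.mem_ker, LinearMap.sub_apply, LinearMap.smul_apply, smul_eq_mul] at this
    apply hij; linarith
  set T := {H : Submodule ℝ (Fin d → ℝ) |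
        SpannedSubspace X H ∧ Module.finrank ℝ H = d - 1 ∧ W ≤ H} with hT
  have hmem : ∀ i, (f k (X i) ≠ 0 ∨ f k' (X i) ≠ 0) → H i ∈ T :=
    fun i hi => ⟨⟨_, rfl⟩, hHr i hi, hWH i⟩
  have hTc := hII W ⟨_, rfl⟩ hWr
  rw [← hT] at hTc
  have hfin : T.Finite := Set.finite_of_ncard_ne_zero (by omega)
  have e1 : f k (X (b k)) = 1 := by simp [h k k]
  have e2 : f k (X (b k')) = 0 := by simp [h k k', hk]
  have e3 : f k' (X (b k)) = 0 := by simp [h k' k, hk.symm]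
  have e4 : f k' (X (b k')) = 1 := by simp [h k' k']
  have hsub : (({H (b k), H (b k'), H i, H j} : Finset (Submodule ℝ (Fin d → ℝ))) : Set _) ⊆ T := by
    intro V hV
    simp only [Finset.coe_insert, Finset.coe_singleton, Set.mem_insert_iff, Set.mem_singleton_iff] at hV
    rcases hV with rfl | rfl | rfl | rfl
    · exact hmem _ (by simp [e1])
    · exact hmem _ (by simp [e4])
    · exact hmem _ (Or.inl h1)
    · exact hmem _ (Or.inl h2)
  have hle := Set.ncard_le_ncard hsub hfin
  rw [Set.ncard_coe_finset] at hle
  have n1 : H (b k) ≠ H (b k') := hHne _ _ (by simp [e1, e2, e3, e4])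
  have n2 : H (b k) ≠ H i := hHne _ _ (by simp [e1, e3, h3])
  have n3 : H (b k) ≠ H j := hHne _ _ (by simp [e1, e3, h4])
  have n4 : H (b k') ≠ H i := hHne _ _ (by simp [e2, e4, h1.symm])
  have n5 : H (b k') ≠ H j := hHne _ _ (by simp [e2, e4, h2.symm])
  have n6 : H i ≠ H j := hHne _ _ hne
  have : ({H (b k), H (b k'), H i, H j} : Finset (Submodule ℝ (Fin d → ℝ))).card = 4 := by
    simp [Finset.card_insert_of_notMem, n1, n2, n3, n4, n5, n6]
  omega

/-- Walks in the bipartite row/column graph of `D`, with length and holonomy. -/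
inductive RWalk (D : Fin d → Fin n → ℝ) : ℕ → Fin d → Fin d → ℝ → Prop
  | nil (k) : RWalk D 0 k k 1
  | cons {m k k₁ k' h} (j : Fin n) (h0 : D k j ≠ 0) (h1 : D k₁ j ≠ 0) (w : RWalk D m k₁ k' h) :
      RWalk D (m + 1) k k' (|D k₁ j| / |D k j| * h)

theorem RWalk.trans {D : Fin d → Fin n → ℝ} {m k k' h} (w : RWalk D m k k' h) :
    ∀ {m' k'' h'}, RWalk D m' k' k'' h' → ∃ m'', RWalk D m'' k k'' (h * h') := by
  induction w with
  | nil k => intro m' k'' h' w'; exact ⟨_, by simpa using w'⟩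
  | cons j h0 h1 w ih =>
    intro m' k'' h' w'
    obtain ⟨m'', w''⟩ := ih w'
    exact ⟨_, by simpa [mul_assoc] using RWalk.cons j h0 h1 w''⟩

theorem RWalk.symm {D : Fin d → Fin n → ℝ} {m k k' h} (w : RWalk D m k k' h) :
    ∃ m', RWalk D m' k' k h⁻¹ := by
  induction w with
  | nil k => exact ⟨0, by simpa using RWalk.nil k⟩
  | cons j h0 h1 w ih =>
    obtain ⟨m', w'⟩ := ih
    obtain ⟨m'', w''⟩ := w'.trans (RWalk.cons j h1 h0 (RWalk.nil _))
    refine ⟨m'', ?_⟩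
    convert w'' using 1
    simp [mul_comm]

theorem RWalk.pos {D : Fin d → Fin n → ℝ} {m k k' h} (w : RWalk D m k k' h) : 0 < h := by
  induction w with
  | nil k => exact one_pos
  | cons j h0 h1 w ih => exact mul_pos (div_pos (abs_pos.2 h1) (abs_pos.2 h0)) ih

/-- Either a walk meets `P` at some later vertex, or each entry used along it survives a change
of matrix that only changes rows in `P`. -/
theorem RWalk.split {D : Fin d → Fin n → ℝ} (P : Fin d → Prop) (D' : Fin d → Fin n → ℝ)
    (hD : ∀ k, ¬ P k → ∀ j, D' k j = D k j) {m k k' h} (w : RWalk D m k k' h) :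
    (∃ a kt c h1 h2, RWalk D (a + 1) k kt h1 ∧ RWalk D c kt k' h2 ∧ a + 1 + c = m ∧ h = h1 * h2
      ∧ P kt) ∨
    ((¬ P k → RWalk D' m k k' h) ∧ (m = 0 ∨ ¬ P k')) := by
  induction w with
  | nil k => exact Or.inr ⟨fun _ => RWalk.nil k, Or.inl rfl⟩
  | @cons m k k₁ k' h j h0 h1 w ih =>
    by_cases hP : P k₁
    · left
      exact ⟨0, k₁, m, _, h, RWalk.cons j h0 h1 (RWalk.nil _), w, by omega, by simp, hP⟩
    rcases ih with ⟨a, kt, c, g1, g2, w1, w2, e, rfl, hkt⟩ | ⟨ih, ih'⟩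
    · left
      exact ⟨a + 1, kt, c, _, g2, RWalk.cons j h0 h1 w1, w2, by omega, by ring, hkt⟩
    · right
      refine ⟨fun hk => ?_, Or.inr ?_⟩
      · rw [← hD k hk, ← hD k₁ hP]
        exact RWalk.cons j (by rwa [hD k hk]) (by rwa [hD k₁ hP]) (ih hP)
      · rcases ih' with rfl | h'
        · cases w; exact hP
        · exact h'

theorem GoodSys.holonomy {X : Fin n → Fin d → ℝ} (hd : 2 ≤ d) (hII : ConditionII X) (m : ℕ) :
    ∀ {f : Fin d → ((Fin d → ℝ) →ₗ[ℝ] ℝ)} {b : Fin d → Fin n} (_ : GoodSys X f b)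
    {k k' : Fin d} {h : ℝ} (_ : RWalk (fun k i => f k (X i)) m k k' h) (c : Fin n)
    (_ : f k (X c) ≠ 0) (_ : f k' (X c) ≠ 0), h = |f k' (X c)| / |f k (X c)| := by
  induction m using Nat.strong_induction_on with
  | _ m IH =>
  intro f b hf k k' h w c hc hc'
  have two : ∀ {k k' : Fin d} {i j : Fin n}, f k (X i) ≠ 0 → f k (X j) ≠ 0 → f k' (X i) ≠ 0 →
      f k' (X j) ≠ 0 → |f k' (X j)| / |f k (X j)| = |f k' (X i)| / |f k (X i)| := by
    intro k k' i j a1 a2 a3 a4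
    by_cases e : k = k'
    · subst e; rw [div_self (abs_ne_zero.2 a1), div_self (abs_ne_zero.2 a2)]
    · rw [div_eq_div_iff (abs_ne_zero.2 a2) (abs_ne_zero.2 a1), ← abs_mul, ← abs_mul]
      have := hf.minor hd hII e a1 a2 a3 a4
      rw [mul_comm (f k' (X j)), this, mul_comm]
  cases w with
  | nil => rw [div_self (abs_ne_zero.2 hc)]
  | @cons m _ k₁ _ h j h0 h1 w =>
  have p0 := abs_ne_zero.2 h0
  have p1 := abs_ne_zero.2 h1
  have pc := abs_ne_zero.2 hc
  have pc' := abs_ne_zero.2 hc'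
  by_cases hk1 : f k₁ (X c) ≠ 0
  · rw [IH m (by omega) hf w c hk1 hc', two hc h0 hk1 h1]
    have := abs_ne_zero.2 hk1
    field_simp
  push Not at hk1
  have hkk : k ≠ k₁ := by rintro rfl; exact hc hk1
  -- now pass to the rest of the walk
  cases w with
  | nil => exact absurd hk1 hc'
  | @cons m _ k₂ _ h j₂ g0 g1 w =>
  have q0 := abs_ne_zero.2 g0
  have q1 := abs_ne_zero.2 g1
  by_cases hch : f k (X j₂) ≠ 0
  · have := IH (m + 1) (by omega) hf (RWalk.cons (D := fun k i => f k (X i)) j₂ hch g1 w) c hc hc'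
    have q2 := abs_ne_zero.2 hch
    rw [← this, two hch h0 g0 h1]
    field_simp
  push Not at hch
  set f' : Fin d → ((Fin d → ℝ) →ₗ[ℝ] ℝ) := fun l => if l = k then (f k (X j))⁻¹ • f k
      else f l - (f l (X j) * (f k (X j))⁻¹) • f k with hf'
  have good' := hf.pivot k j h0
  have hD : ∀ l, ¬ (f l (X j) ≠ 0) → ∀ i, f' l (X i) = f l (X i) := by
    intro l hl i
    push Not at hl
    have : l ≠ k := by rintro rfl; exact h0 hl
    simp [hf', this, hl]
  -- a later vertex of the walk on column `j` closes two shorter cycles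
  have key : ∀ a kt e h1' h2', RWalk (fun k i => f k (X i)) (a + 1) k₁ kt h1' →
      RWalk (fun k i => f k (X i)) e kt k' h2' → a + 1 + e = m + 1 → f kt (X j) ≠ 0 →
      |f k₁ (X j)| / |f k (X j)| * (h1' * h2') = |f k' (X c)| / |f k (X c)| := by
    intro a kt e h1' h2' w1 w2 hae hkt
    have i1 := IH (e + 1) (by omega) hf (RWalk.cons (D := fun k i => f k (X i)) j h0 hkt w2) c hc hc'
    have i2 := IH (a + 1) (by omega) hf w1 j h1 hkt
    rw [← i1, i2]
    have := abs_ne_zero.2 hkt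
    field_simp
  rcases RWalk.split (fun l => f l (X j) ≠ 0) (fun l i => f' l (X i)) hD w with
    ⟨a, kt, e, h1', h2', w1, w2, hae, rfl, hkt⟩ | ⟨w', hk'⟩
  · rw [← mul_assoc (|f k₂ (X j₂)| / |f k₁ (X j₂)|)]
    exact key (a + 1) kt e _ h2' (RWalk.cons (D := fun k i => f k (X i)) j₂ g0 g1 w1) w2 (by omega) hkt
  by_cases hk2 : f k₂ (X j) ≠ 0
  · have := key 0 k₂ m _ h (RWalk.cons (D := fun k i => f k (X i)) j₂ g0 g1 (RWalk.nil _)) w (by omega) hk2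
    simpa using this
  have hk'j : ¬ (f k' (X j) ≠ 0) := by
    rcases hk' with rfl | hk'
    · cases w; exact hk2
    · exact hk'
  have v1 : f' k₁ (X j₂) = f k₁ (X j₂) := by simp [hf', hkk.symm, hch]
  have v2 : f' k₁ (X c) = - (f k₁ (X j) * (f k (X j))⁻¹ * f k (X c)) := by
    simp [hf', hkk.symm, hk1]
  have w'' := RWalk.cons (D := fun l i => f' l (X i)) (k := k₁) j₂ (by simpa only [v1] using g0)
    (by simpa only [hD k₂ hk2] using g1) (w' hk2)
  have := IH (m + 1) (by omega) good' w'' c (by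
    change f' k₁ (X c) ≠ 0
    rw [v2]; exact neg_ne_zero.2 (mul_ne_zero (mul_ne_zero h1 (inv_ne_zero h0)) hc))
    (by change f' k' (X c) ≠ 0; rwa [hD k' hk'j])
  change |f' k₂ (X j₂)| / |f' k₁ (X j₂)| * h = |f' k' (X c)| / |f' k₁ (X c)| at this
  rw [hD k₂ hk2, v1, v2, hD k' hk'j, abs_neg, abs_mul, abs_mul, abs_inv] at this
  rw [this]
  field_simp

theorem GoodSys.scaling {X : Fin n → Fin d → ℝ} (hd : 2 ≤ d) (hII : ConditionII X)
    {f : Fin d → ((Fin d → ℝ) →ₗ[ℝ] ℝ)} {b : Fin d → Fin n} (hf : GoodSys X f b) :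
    ∃ (a : Fin d → ℝ) (lam : Fin n → ℝ), (∀ k, 0 < a k) ∧ (∀ i, 0 < lam i) ∧
      ∀ k i, f k (X i) ≠ 0 → |f k (X i)| = a k * lam i := by
  classical
  let D : Fin d → Fin n → ℝ := fun k i => f k (X i)
  let s : Setoid (Fin d) :=
    { r := fun k k' => ∃ m h, RWalk D m k k' h
      iseqv := ⟨fun k => ⟨_, _, RWalk.nil k⟩,
        fun ⟨_, _, w⟩ => let ⟨m', w'⟩ := w.symm; ⟨m', _, w'⟩,
        fun ⟨_, _, w⟩ ⟨_, _, w'⟩ => let ⟨m', w''⟩ := w.trans w'; ⟨m', _, w''⟩⟩ }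
  have hroot : ∀ k : Fin d, ∃ m h, RWalk D m (Quotient.mk s k).out k h := fun k =>
    Quotient.exact (Quotient.out_eq (Quotient.mk s k))
  choose len a hw using hroot
  have closed : ∀ {m k h}, RWalk D m k k h → h = 1 := by
    intro m k h w
    have e : f k (X (b k)) ≠ 0 := by simp [hf k k]
    rw [hf.holonomy hd hII m w (b k) e e, div_self (abs_ne_zero.2 e)]
  have hstep : ∀ k k' i, D k i ≠ 0 → D k' i ≠ 0 → a k' * |D k i| = a k * |D k' i| := by
    intro k k' i h0 h1
    have st := RWalk.cons i h0 h1 (RWalk.nil k')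
    have hq : Quotient.mk s k = Quotient.mk s k' := Quotient.sound ⟨_, _, st⟩
    obtain ⟨_, w1⟩ := (hw k).trans st
    obtain ⟨_, w2⟩ := (hw k').symm
    rw [hq] at w1
    obtain ⟨_, w3⟩ := w1.trans w2
    have := closed w3
    have p := (hw k').pos.ne'
    have p0 := abs_ne_zero.2 h0
    field_simp at this
    linarith
  refine ⟨a, fun i => if hi : ∃ k, D k i ≠ 0 then |D hi.choose i| / a hi.choose else 1,
    fun k => (hw k).pos, ?_, ?_⟩
  · intro i
    dsimp only
    split_ifs with hi
    · exact div_pos (abs_pos.2 hi.choose_spec) (hw _).pos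
    · exact one_pos
  · intro k i hki
    have hi : ∃ k, D k i ≠ 0 := ⟨k, hki⟩
    simp only [dif_pos hi]
    have := hstep k hi.choose i hki hi.choose_spec
    have p := (hw hi.choose).pos.ne'
    field_simp
    change |D k i| * _ = _
    linarith

theorem exists_goodBasis (X : Fin n → Fin d → ℝ) (hX : Submodule.span ℝ (Set.range X) = ⊤) :
    ∃ (B : Module.Basis (Fin d) ℝ (Fin d → ℝ)) (b : Fin d → Fin n), ∀ k, B k = X (b k) := by
  obtain ⟨t, ht, hsp, hli⟩ := exists_linearIndependent ℝ (Set.range X)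
  let B0 : Module.Basis t ℝ (Fin d → ℝ) := Module.Basis.mk hli (by
    rw [Subtype.range_coe, hsp, hX])
  have : Fintype t := FiniteDimensional.fintypeBasisIndex B0
  have hc : Fintype.card t = d := by
    rw [← Module.finrank_eq_card_basis B0, Module.finrank_fin_fun]
  let e : t ≃ Fin d := Fintype.equivFinOfCardEq hc
  have hb : ∀ k, ∃ i, X i = B0.reindex e k := by
    intro k
    have : B0.reindex e k ∈ t := by simp [B0]
    exact ht this
  choose b hb using hb
  exact ⟨B0.reindex e, b, fun k => (hb k).symm⟩

theorem sgnR_eq_zero (t : ℝ) : sgnR t = 0 ↔ t = 0 := by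
  unfold sgnR
  split_ifs with h1 h2
  · simp [h1.ne']
  · simp [h2.ne]
  · simp; linarith

theorem sgnR_mul_abs (t : ℝ) : (sgnR t : ℝ) * |t| = t := by
  unfold sgnR
  split_ifs with h1 h2
  · simp [abs_of_pos h1]
  · simp [abs_of_neg h2]
  · have : t = 0 := by linarith
    simp [this]

theorem coord_isCocircuit (X : Fin n → Fin d → ℝ) (B : Module.Basis (Fin d) ℝ (Fin d → ℝ))
    (b : Fin d → Fin n) (hB : ∀ k, B k = X (b k)) (k : Fin d) :
    IsCocircuit X (fun i => sgnR (B.coord k (X i))) := by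
  refine ⟨⟨B.coord k, fun i => rfl⟩, ?_, ?_⟩
  · intro h0
    have := congrFun h0 (b k)
    simp only [Pi.zero_apply, sgnR_eq_zero] at this
    rw [← hB] at this
    simp at this
  · rintro t ⟨g, hg⟩ ht hss
    have hz : ∀ i, B.coord k (X i) = 0 → g (X i) = 0 := by
      intro i hi
      by_contra hgi
      have : i ∈ supp t := by
        change t i ≠ 0
        rwa [hg, Ne, sgnR_eq_zero]
      have := hss.1 this
      exact this (by simp only [sgnR_eq_zero]; exact hi)
    have hgk : g = g (B k) • B.coord k := by
      apply B.ext
      intro l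
      by_cases hl : l = k
      · subst hl; simp
      · rw [hB l, hz (b l) (by rw [← hB]; simp [hl]), ← hB]
        simp [hl]
    have hgk0 : g (B k) ≠ 0 := by
      intro h0
      apply ht
      funext i
      rw [hg, hgk, h0]
      simp [sgnR_eq_zero]
    apply hss.2
    intro i hi
    change t i ≠ 0
    have hi' : B.coord k (X i) ≠ 0 := fun h => hi (by simp only [sgnR_eq_zero]; exact h)
    rw [hg, Ne, sgnR_eq_zero, hgk]
    simpa [hgk0] using hi'

end Helpers

/-- If `X` spans `ℝ^d` (`d ≥ 2`) and satisfies McMullen's condition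
(II), then `X` is projectively equivalent to the configuration `yᵢ = π eᵢ` of
projections of the standard basis onto the real span of the cocircuit lattice of
`X`. -/
theorem conditionII_projectivelyEquivalent {n d : ℕ} (hd : 2 ≤ d)
    (X : Fin n → Fin d → ℝ) (hX : Submodule.span ℝ (Set.range X) = ⊤)
    (hII : ConditionII X)
    (proj : (Fin n → ℝ) →ₗ[ℝ] (Fin n → ℝ))
    (hmem : ∀ z, proj z ∈ latticeSpan (cocircuitLattice X))
    (horth : ∀ z, ∀ w ∈ latticeSpan (cocircuitLattice X),
      ∑ i, (z - proj z) i * w i = 0) :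
    ∃ (A : (Fin n → ℝ) →ₗ[ℝ] (Fin d → ℝ)) (lam : Fin n → ℝ),
      (∀ i, lam i ≠ 0) ∧ ∀ i, X i = lam i • A (proj (Pi.single i 1)) := by
  classical
  obtain ⟨B, b, hB⟩ := exists_goodBasis X hX
  have hf : GoodSys X (fun k => B.coord k) b := by
    intro k l
    rw [← hB]
    simp [Finsupp.single_apply, eq_comm]
  obtain ⟨a, lam, ha, hlam, hs⟩ := hf.scaling hd hII
  have hrow : ∀ k, (fun i => B.coord k (X i) / lam i) ∈ latticeSpan (cocircuitLattice X) := by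
    intro k
    have h1 : icast (fun i => sgnR (B.coord k (X i))) ∈ latticeSpan (cocircuitLattice X) :=
      Submodule.subset_span ⟨_, AddSubgroup.subset_closure (coord_isCocircuit X B b hB k), rfl⟩
    have h2 : (fun i => B.coord k (X i) / lam i)
        = a k • icast (fun i => sgnR (B.coord k (X i))) := by
      funext i
      simp only [icast, Pi.smul_apply, smul_eq_mul]
      by_cases h0 : B.coord k (X i) = 0
      · rw [h0, (sgnR_eq_zero 0).2 rfl]; simp
      · rw [div_eq_iff (hlam i).ne']
        have := sgnR_mul_abs (B.coord k (X i))
        rw [hs k i h0] at this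
        linarith
    rw [h2]
    exact Submodule.smul_mem _ _ h1
  have hw : ∀ j, (fun i => X i j / lam i) ∈ latticeSpan (cocircuitLattice X) := by
    intro j
    have : (fun i => X i j / lam i) = ∑ k, B k j • (fun i => B.coord k (X i) / lam i) := by
      funext i
      have := congrFun (B.sum_repr (X i)) j
      rw [Finset.sum_apply] at this
      rw [← this, Finset.sum_apply, Finset.sum_div]
      refine Finset.sum_congr rfl fun k _ => ?_
      simp
      ring
    rw [this]
    exact Submodule.sum_mem _ fun k _ => Submodule.smul_mem _ _ (hrow k)
  refine ⟨LinearMap.pi fun j => ∑ i, (X i j / lam i) • LinearMap.proj i, lam,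
    fun i => (hlam i).ne', fun i => ?_⟩
  funext j
  have h1 := horth (Pi.single i 1) _ (hw j)
  simp only [Pi.sub_apply, sub_mul, Finset.sum_sub_distrib] at h1
  rw [Finset.sum_eq_single i (by intro l _ hl; simp [hl]) (by simp)] at h1
  simp only [Pi.single_eq_same, one_mul] at h1
  have h2 : (∑ l, (X l j / lam l) * proj (Pi.single i 1) l) = X i j / lam i := by
    rw [sub_eq_zero] at h1
    rw [h1]
    exact Finset.sum_congr rfl fun l _ => mul_comm _ _
  simp only [Pi.smul_apply, LinearMap.pi_apply, LinearMap.sum_apply, LinearMap.smul_apply,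
    LinearMap.proj_apply, smul_eq_mul]
  rw [h2, mul_div_cancel₀ _ (hlam i).ne']
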